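/- arXiv:math/9902127 — 2 statements merged into one kernel-verified Lean document; each statement's English description precedes it below -/
import Mathlib

section
/- Let V be a finite-dimensional vector space and {Λᵢ : i ∈ I} a family of nonzero decomposable n-vectors in ΛⁿV such that every sum Λᵢ + Λⱼ (i ≠ j) is decomposable. Then either the linear span of the subspaces D_{Λᵢ} is at most (n+1)-dimensional, or the intersection ∩ᵢ D_{Λᵢ} is at least (n−1)-dimensional. -/
/-- The wedge product `v₁ ∧ … ∧ vₙ` in the exterior algebra. -/
def wedgeProd (K : Type*) {V : Type*} [Field K] [AddCommGroup V] [Module K V] {n : ℕ}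
    (v : Fin n → V) : ExteriorAlgebra K V :=
  (List.ofFn fun i => ExteriorAlgebra.ι K (v i)).prod

/-- The subspace `D_Λ = {v : V | v ∧ Λ = 0}` determined by an `n`-vector `Λ`. -/
def decompSpan (K : Type*) {V : Type*} [Field K] [AddCommGroup V] [Module K V]
    (Λ : ExteriorAlgebra K V) : Submodule K V :=
  LinearMap.ker ((LinearMap.mulRight K Λ).comp (ExteriorAlgebra.ι K))

theorem aux_sup {K V : Type*} [Field K] [AddCommGroup V] [Module K V] [FiniteDimensional K V]
    {n : ℕ} {A B D : Submodule K V} (hA : A ≤ D) (hB : B ≤ D) (hD : Module.finrank K D = n)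
    (hAn : n - 1 ≤ Module.finrank K A) (hBA : ¬ B ≤ A) : D ≤ A ⊔ B := by
  have h1 : A < A ⊔ B := lt_of_le_of_ne le_sup_left
    (fun h => hBA (by rw [h]; exact le_sup_right))
  have h2 := Submodule.finrank_lt_finrank_of_lt h1
  exact (Submodule.eq_of_le_of_finrank_le (sup_le hA hB) (by omega)).ge

theorem aux_comb {K V : Type*} [Field K] [AddCommGroup V] [Module K V] [FiniteDimensional K V]
    {n : ℕ} {I : Type*} (D : I → Submodule K V) (hD : ∀ i, Module.finrank K (D i) = n)
    (hDD : ∀ i j, n - 1 ≤ Module.finrank K ↥(D i ⊓ D j)) :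
    Module.finrank K ↥(⨆ i, D i) ≤ n + 1 ∨ n - 1 ≤ Module.finrank K ↥(⨅ i, D i) := by
  by_cases hall : ∀ i j, D i = D j
  · left
    rcases isEmpty_or_nonempty I with h | ⟨⟨i⟩⟩
    · rw [iSup_of_empty, finrank_bot]
      omega
    · have : (⨆ j, D j) ≤ D i := iSup_le fun j => (hall j i).le
      have := Submodule.finrank_mono this
      rw [hD] at this
      omega
  push Not at hall
  obtain ⟨a, b, hab⟩ := hall
  have hW : Module.finrank K ↥(D a ⊓ D b) ≤ n - 1 := by
    have h : D a ⊓ D b < D a := by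
      refine lt_of_le_of_ne inf_le_left fun h => hab ?_
      exact Submodule.eq_of_le_of_finrank_eq (inf_eq_left.mp h) (by rw [hD, hD])
    have := Submodule.finrank_lt_finrank_of_lt h
    rw [hD] at this
    omega
  have hWab := hDD a b
  have hU : Module.finrank K ↥(D a ⊔ D b) ≤ n + 1 := by
    have := Submodule.finrank_sup_add_finrank_inf_eq (D a) (D b)
    rw [hD, hD] at this
    omega
  by_cases hk : ∀ k, D a ⊓ D b ≤ D k
  · right
    exact hWab.trans (Submodule.finrank_mono (le_iInf hk))
  push Not at hk
  obtain ⟨c, hc⟩ := hk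
  have key : ∀ k, ¬ D a ⊓ D b ≤ D k → D k ≤ D a ⊔ D b := by
    intro k hk
    refine (aux_sup (A := D k ⊓ D a) (B := D k ⊓ D b) inf_le_left inf_le_left (hD k)
      (hDD k a) ?_).trans (sup_le_sup inf_le_right inf_le_right)
    intro h
    have h1 : D k ⊓ D b ≤ D a ⊓ D b := le_inf (h.trans inf_le_right) inf_le_right
    have h2 := Submodule.eq_of_le_of_finrank_le h1 (hW.trans (hDD k b))
    exact hk (h2 ▸ inf_le_left)
  left
  refine le_trans (Submodule.finrank_mono (iSup_le fun k => ?_)) hU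
  by_cases hk : D a ⊓ D b ≤ D k
  · refine (aux_sup (A := D a ⊓ D b) (B := D k ⊓ D c) hk inf_le_left (hD k)
      hWab ?_).trans (sup_le (inf_le_left.trans le_sup_left) (inf_le_right.trans (key c hc)))
    intro h
    have h2 := Submodule.eq_of_le_of_finrank_le h (hW.trans (hDD k c))
    exact hc (h2 ▸ inf_le_right)
  · exact key k hk

theorem aux_ne {K V : Type*} [Field K] [AddCommGroup V] [Module K V]
    {n : ℕ} (v : Fin n → V) : wedgeProd K v ≠ 0 ↔ LinearIndependent K v := by
  have e : wedgeProd K v = ExteriorAlgebra.ιMulti K n v := rfl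
  constructor
  · intro h
    by_contra hv
    exact h (by rw [e]; exact AlternatingMap.map_linearDependent _ v hv)
  · intro hv h
    have h1 := exteriorPower.ιMulti_family_linearIndependent_field (n := n) hv
    have h2 := h1.ne_zero (Set.powersetCard.ofFinEmbEquiv (RelEmbedding.refl _))
    apply h2
    apply Subtype.ext
    simp only [exteriorPower.ιMulti_family, Equiv.symm_apply_apply]
    exact h

theorem aux_cons {K V : Type*} [Field K] [AddCommGroup V] [Module K V]
    {n : ℕ} (w : V) (v : Fin n → V) : 
    wedgeProd K (Fin.cons w v : Fin (n+1) → V) = ExteriorAlgebra.ι K w * wedgeProd K v := by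
  simp [wedgeProd, List.ofFn_succ]

theorem aux_mem {K V : Type*} [Field K] [AddCommGroup V] [Module K V]
    {w : V} {L : ExteriorAlgebra K V} :
    w ∈ decompSpan K L ↔ ExteriorAlgebra.ι K w * L = 0 := by
  simp [decompSpan]

theorem aux_span {K V : Type*} [Field K] [AddCommGroup V] [Module K V]
    {n : ℕ} (v : Fin n → V) (h : wedgeProd K v ≠ 0) :
    decompSpan K (wedgeProd K v) = Submodule.span K (Set.range v) := by
  ext w
  rw [aux_mem, ← aux_cons, ← not_iff_not, ← ne_eq, aux_ne, linearIndependent_finCons]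
  simp [(aux_ne v).1 h]

theorem aux_rank {K V : Type*} [Field K] [AddCommGroup V] [Module K V]
    {n : ℕ} (v : Fin n → V) (h : wedgeProd K v ≠ 0) :
    Module.finrank K (decompSpan K (wedgeProd K v)) = n := by
  rw [aux_span v h, finrank_span_eq_card ((aux_ne v).1 h), Fintype.card_fin]

theorem aux_neg {K V : Type*} [Field K] [AddCommGroup V] [Module K V]
    (L : ExteriorAlgebra K V) : decompSpan K (-L) = decompSpan K L := by
  ext w
  simp [aux_mem]

theorem aux_pair {K V : Type*} [Field K] [AddCommGroup V] [Module K V] [FiniteDimensional K V]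
    {n : ℕ} (a b c : Fin n → V) (ha : wedgeProd K a ≠ 0) (hb : wedgeProd K b ≠ 0)
    (h : wedgeProd K a + wedgeProd K b = wedgeProd K c) :
    n - 1 ≤ Module.finrank K
      ↥(decompSpan K (wedgeProd K a) ⊓ decompSpan K (wedgeProd K b)) := by
  have hra := aux_rank a ha
  have hrb := aux_rank b hb
  by_cases hc : wedgeProd K c = 0
  · rw [hc, add_eq_zero_iff_eq_neg] at h
    rw [h, aux_neg, inf_idem, hrb]
    omega
  have hrc := aux_rank c hc
  have hv : ∀ v ∈ decompSpan K (wedgeProd K c),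
      ExteriorAlgebra.ι K v * wedgeProd K a = - (ExteriorAlgebra.ι K v * wedgeProd K b) := by
    intro v hv
    rw [aux_mem, ← h, mul_add] at hv
    exact eq_neg_of_add_eq_zero_left hv
  by_cases hall : decompSpan K (wedgeProd K c) ≤ decompSpan K (wedgeProd K a)
  · have : decompSpan K (wedgeProd K c) ≤ decompSpan K (wedgeProd K a) ⊓ decompSpan K (wedgeProd K b) := by
      refine le_inf hall fun v hvc => ?_
      have h1 := hv v hvc
      rw [aux_mem.1 (hall hvc)] at h1
      exact aux_mem.2 (neg_eq_zero.1 h1.symm)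
    have := Submodule.finrank_mono this
    omega
  obtain ⟨v, hvc, hva⟩ := Set.not_subset.1 hall
  have h1 := hv v hvc
  have hva' : ExteriorAlgebra.ι K v * wedgeProd K a ≠ 0 := fun h => hva (aux_mem.2 h)
  have hvb' : ExteriorAlgebra.ι K v * wedgeProd K b ≠ 0 := fun h => hva' (by rw [h1, h, neg_zero])
  have hle : ∀ d : Fin n → V, wedgeProd K d ≠ 0 → ExteriorAlgebra.ι K v * wedgeProd K d ≠ 0 →
      decompSpan K (wedgeProd K d) ≤ decompSpan K (ExteriorAlgebra.ι K v * wedgeProd K d) := by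
    intro d hd hvd
    rw [← aux_cons] at hvd ⊢
    rw [aux_span d hd, aux_span _ hvd, Fin.range_cons]
    exact Submodule.span_mono (Set.subset_insert _ _)
  have hsup : decompSpan K (wedgeProd K a) ⊔ decompSpan K (wedgeProd K b) ≤
      decompSpan K (ExteriorAlgebra.ι K v * wedgeProd K a) := by
    refine sup_le (hle a ha hva') ?_
    rw [h1, aux_neg]
    exact hle b hb hvb'
  have hr := Submodule.finrank_mono hsup
  rw [← aux_cons] at hr hva'
  rw [aux_rank _ hva'] at hr
  have := Submodule.finrank_sup_add_finrank_inf_eq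
    (decompSpan K (wedgeProd K a)) (decompSpan K (wedgeProd K b))
  omega

/-- Lemma on three planes: a family of nonzero decomposable `n`-vectors with pairwise
decomposable sums either spans at most `n+1` dimensions or has common intersection of
dimension at least `n−1`. -/
theorem lemma_on_three_planes {K V : Type*} [Field K] [AddCommGroup V]
    [Module K V] [FiniteDimensional K V] {n : ℕ} {I : Type*}
    (Λ : I → ExteriorAlgebra K V)
    (hdec : ∀ i, ∃ v : Fin n → V, Λ i = wedgeProd K v)
    (hne : ∀ i, Λ i ≠ 0)
    (hsum : ∀ i j, i ≠ j → ∃ v : Fin n → V, Λ i + Λ j = wedgeProd K v) :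
    Module.finrank K ↥(⨆ i, decompSpan K (Λ i)) ≤ n + 1 ∨
    n - 1 ≤ Module.finrank K ↥(⨅ i, decompSpan K (Λ i)) := by
  have hr : ∀ i, Module.finrank K (decompSpan K (Λ i)) = n := by
    intro i
    obtain ⟨v, hv⟩ := hdec i
    have := hne i
    rw [hv] at this ⊢
    exact aux_rank v this
  refine aux_comb (fun i => decompSpan K (Λ i)) hr fun i j => ?_
  change n - 1 ≤ Module.finrank K ↥(decompSpan K (Λ i) ⊓ decompSpan K (Λ j))
  by_cases hij : i = j
  · subst hij
    rw [inf_idem, hr]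
    omega
  obtain ⟨a, ha⟩ := hdec i
  obtain ⟨b, hb⟩ := hdec j
  obtain ⟨c, hc⟩ := hsum i j hij
  have h1 := hne i
  have h2 := hne j
  rw [ha] at h1 hc
  rw [hb] at h2 hc
  rw [ha, hb]
  exact aux_pair a b c h1 h2 hc
end

section
/- Let G be a group, 𝔤 a finite-dimensional representation of G via Ad : G → GL(𝔤), and Λ̃ : G → Λⁿ𝔤 a 1-cocycle, i.e. Λ̃(gg') = Λ̃(g) + Ad_g Λ̃(g'). Suppose all values Λ̃(g) are decomposable n-vectors. Let G₀ = {g : Λ̃(g) ≠ 0}, V_∪ = span{D_{Λ̃(g)} : g ∈ G₀} and V_∩ = ∩_{g∈G₀} D_{Λ̃(g)}. Then V_∪ and V_∩ are Ad_G-invariant subspaces of 𝔤, and either dim V_∪ ≤ n+1 or dim V_∩ ≥ n−1. -/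
section Helpers

variable {K V : Type*} [Field K] [AddCommGroup V] [Module K V]

lemma mem_decompSpan {A : ExteriorAlgebra K V} {w : V} :
    w ∈ decompSpan K A ↔ ExteriorAlgebra.ι K w * A = 0 := by
  simp [decompSpan]

lemma wedgeProd_eq {n : ℕ} (v : Fin n → V) :
    wedgeProd K v = ExteriorAlgebra.ιMulti K n v := rfl

lemma wedgeProd_cons {n : ℕ} (w : V) (v : Fin n → V) :
    wedgeProd K (Fin.cons w v : Fin (n+1) → V) = ExteriorAlgebra.ι K w * wedgeProd K v := by
  simp [wedgeProd, List.ofFn_succ]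

lemma map_wedgeProd {n : ℕ} (f : V →ₗ[K] V) (v : Fin n → V) :
    ExteriorAlgebra.map f (wedgeProd K v) = wedgeProd K (f ∘ v) :=
  ExteriorAlgebra.map_apply_ιMulti f v

lemma self_mem_decompSpan {n : ℕ} (v : Fin n → V) (i : Fin n) :
    v i ∈ decompSpan K (wedgeProd K v) := by
  rw [mem_decompSpan, ← wedgeProd_cons, wedgeProd_eq]
  exact (ExteriorAlgebra.ιMulti K (n+1)).map_eq_zero_of_eq _ (i := 0) (j := i.succ)
    (by simp) (Fin.succ_ne_zero i).symm

/-- Left contraction with a linear form. -/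
noncomputable def ctr (d : V →ₗ[K] K) : ExteriorAlgebra K V →ₗ[K] ExteriorAlgebra K V :=
  CliffordAlgebra.contractLeft (Q := (0 : QuadraticForm K V)) d

lemma ctr_ι_mul (d : V →ₗ[K] K) (w : V) (A : ExteriorAlgebra K V) :
    ctr d (ExteriorAlgebra.ι K w * A) = d w • A - ExteriorAlgebra.ι K w * ctr d A :=
  CliffordAlgebra.contractLeft_ι_mul (Q := (0 : QuadraticForm K V)) d w A

lemma ctr_wedgeProd (d : V →ₗ[K] K) : ∀ {n : ℕ} (v : Fin n → V), (∀ i, d (v i) = 0) →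
    ctr d (wedgeProd K v) = 0
  | 0, v, _ => by
    have : wedgeProd K v = 1 := by simp [wedgeProd]
    rw [this]
    exact CliffordAlgebra.contractLeft_one (Q := (0 : QuadraticForm K V)) d
  | n+1, v, h => by
    rw [← Fin.cons_self_tail v, wedgeProd_cons, ctr_ι_mul,
      ctr_wedgeProd d (Fin.tail v) (fun i => h i.succ), h 0]
    simp

lemma ctr_eq_zero {n : ℕ} {A : ExteriorAlgebra K V} (hA : ∃ v : Fin n → V, A = wedgeProd K v)
    (d : V →ₗ[K] K) (h : A ≠ 0 → decompSpan K A ≤ LinearMap.ker d) : ctr d A = 0 := by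
  by_cases h0 : A = 0
  · simp [h0]
  obtain ⟨v, rfl⟩ := hA
  exact ctr_wedgeProd d v fun i => h h0 (self_mem_decompSpan v i)

lemma decompSpan_sub_le {n : ℕ} {A B : ExteriorAlgebra K V}
    (hA : ∃ v : Fin n → V, A = wedgeProd K v) (hB : ∃ v : Fin n → V, B = wedgeProd K v)
    (hne : A ≠ B) (E : Submodule K V) (hAE : A ≠ 0 → decompSpan K A ≤ E)
    (hBE : B ≠ 0 → decompSpan K B ≤ E) : decompSpan K (A - B) ≤ E := by
  intro w hw
  by_contra hwE
  obtain ⟨d, hdw, hd⟩ := Submodule.exists_le_ker_of_notMem hwE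
  rw [mem_decompSpan] at hw
  have h1 := congrArg (ctr d) hw
  rw [ctr_ι_mul, map_sub, ctr_eq_zero hA d fun h => (hAE h).trans hd,
    ctr_eq_zero hB d fun h => (hBE h).trans hd] at h1
  simp [hdw, sub_eq_zero, hne] at h1

lemma decompSpan_eq_span {n : ℕ} (v : Fin n → V) (h : wedgeProd K v ≠ 0) :
    decompSpan K (wedgeProd K v) = Submodule.span K (Set.range v) := by
  apply le_antisymm
  · intro w hw
    by_contra hwE
    obtain ⟨d, hdw, hd⟩ := Submodule.exists_le_ker_of_notMem hwE
    rw [mem_decompSpan] at hw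
    have h1 := congrArg (ctr d) hw
    rw [ctr_ι_mul, ctr_wedgeProd d v fun i => hd (Submodule.subset_span ⟨i, rfl⟩)] at h1
    simp [hdw, h] at h1
  · rw [Submodule.span_le]
    rintro _ ⟨i, rfl⟩
    exact self_mem_decompSpan v i

lemma finrank_decompSpan {n : ℕ} {A : ExteriorAlgebra K V}
    (hA : ∃ v : Fin n → V, A = wedgeProd K v) (h : A ≠ 0) :
    Module.finrank K (decompSpan K A) = n := by
  obtain ⟨v, rfl⟩ := hA
  rw [decompSpan_eq_span v h]
  have hli : LinearIndependent K v := by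
    by_contra hl
    exact h ((ExteriorAlgebra.ιMulti K n).map_linearDependent v hl)
  simpa using finrank_span_eq_card hli

lemma inter_dim [FiniteDimensional K V] {n : ℕ} {A B : ExteriorAlgebra K V}
    (hA : ∃ v : Fin n → V, A = wedgeProd K v) (hB : ∃ v : Fin n → V, B = wedgeProd K v)
    (hC : ∃ v : Fin n → V, A - B = wedgeProd K v) (hA0 : A ≠ 0) (hB0 : B ≠ 0) :
    n ≤ Module.finrank K ↥(decompSpan K A ⊓ decompSpan K B) + 1 := by
  have rA := finrank_decompSpan hA hA0
  have rB := finrank_decompSpan hB hB0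
  by_cases hAB : A = B
  · subst hAB
    rw [inf_idem]
    omega
  have rC := finrank_decompSpan hC (sub_ne_zero.2 hAB)
  by_cases hle : decompSpan K (A - B) ≤ decompSpan K A ⊓ decompSpan K B
  · have := Submodule.finrank_mono hle
    omega
  obtain ⟨w, hw, hw2⟩ := SetLike.not_le_iff_exists.1 hle
  rw [mem_decompSpan, mul_sub, sub_eq_zero] at hw
  have hwA : ExteriorAlgebra.ι K w * A ≠ 0 := by
    intro h0
    exact hw2 ⟨mem_decompSpan.2 h0, mem_decompSpan.2 (hw ▸ h0)⟩
  have key : ∀ X : ExteriorAlgebra K V,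
      decompSpan K X ≤ decompSpan K (ExteriorAlgebra.ι K w * X) := by
    intro X u hu
    rw [mem_decompSpan] at hu ⊢
    have := ExteriorAlgebra.ι_add_mul_swap (R := K) u w
    rw [← mul_assoc, eq_neg_of_add_eq_zero_left this, neg_mul, mul_assoc, hu]
    simp
  have hdec : ∃ v : Fin (n+1) → V, ExteriorAlgebra.ι K w * A = wedgeProd K v := by
    obtain ⟨v, rfl⟩ := hA
    exact ⟨_, (wedgeProd_cons w v).symm⟩
  have r := finrank_decompSpan hdec hwA
  have hsup : decompSpan K A ⊔ decompSpan K B ≤ decompSpan K (ExteriorAlgebra.ι K w * A) :=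
    sup_le (key A) (by rw [hw]; exact key B)
  have := Submodule.finrank_mono hsup
  have := Submodule.finrank_sup_add_finrank_inf_eq (decompSpan K A) (decompSpan K B)
  omega

lemma third_plane [FiniteDimensional K V] {n : ℕ} {P Q R : Submodule K V}
    (hP : Module.finrank K P = n) (hR : Module.finrank K R = n)
    (hQ : Module.finrank K Q = n) (hPQ : P ≠ Q)
    (h2 : n ≤ Module.finrank K ↥(R ⊓ P) + 1) (h3 : n ≤ Module.finrank K ↥(R ⊓ Q) + 1)
    (hnot : ¬ P ⊓ Q ≤ R) : R ≤ P ⊔ Q := by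
  have hlt : Module.finrank K ↥(P ⊓ Q) < n := by
    by_contra hge
    push Not at hge
    have e1 : P ⊓ Q = P := Submodule.eq_of_le_of_finrank_le inf_le_left (by omega)
    have e2 : P ⊓ Q = Q := Submodule.eq_of_le_of_finrank_le inf_le_right (by omega)
    exact hPQ (e1.symm.trans e2)
  have hlt2 : Module.finrank K ↥(R ⊓ P ⊓ (R ⊓ Q)) < Module.finrank K ↥(P ⊓ Q) := by
    have hle : R ⊓ P ⊓ (R ⊓ Q) ≤ P ⊓ Q := inf_le_inf inf_le_right inf_le_right
    apply Submodule.finrank_lt_finrank_of_lt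
    refine lt_of_le_of_ne hle fun he => hnot ?_
    rw [← he]
    exact inf_le_left.trans inf_le_left
  have hs := Submodule.finrank_sup_add_finrank_inf_eq (R ⊓ P) (R ⊓ Q)
  have he : R ⊓ P ⊔ R ⊓ Q = R :=
    Submodule.eq_of_le_of_finrank_le (sup_le inf_le_left inf_le_left) (by omega)
  rw [← he]
  exact sup_le_sup inf_le_right inf_le_right

lemma planes [FiniteDimensional K V] {n : ℕ} {I : Type*} (s : Set I) (D : I → Submodule K V)
    (hr : ∀ i ∈ s, Module.finrank K (D i) = n)
    (hp : ∀ i ∈ s, ∀ j ∈ s, n ≤ Module.finrank K ↥(D i ⊓ D j) + 1) :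
    Module.finrank K ↥(⨆ i ∈ s, D i) ≤ n + 1 ∨ n - 1 ≤ Module.finrank K ↥(⨅ i ∈ s, D i) := by
  by_cases hne : ∃ p ∈ s, ∃ q ∈ s, D p ≠ D q
  · obtain ⟨p, hps, q, hqs, hpq⟩ := hne
    have hpqr := hp p hps q hqs
    by_cases hall : ∀ r ∈ s, D p ⊓ D q ≤ D r
    · right
      have := Submodule.finrank_mono (le_iInf₂ hall)
      omega
    · left
      push Not at hall
      obtain ⟨r, hrs, hrn⟩ := hall
      have third : ∀ t ∈ s, ¬ D p ⊓ D q ≤ D t → D t ≤ D p ⊔ D q := fun t ht hn =>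
        third_plane (hr p hps) (hr t ht) (hr q hqs) hpq (hp t ht p hps) (hp t ht q hqs) hn
      have hU : ⨆ i ∈ s, D i ≤ D p ⊔ D q := by
        refine iSup₂_le fun t ht => ?_
        by_cases hW : D p ⊓ D q ≤ D t
        swap
        · exact third t ht hW
        by_contra hnot
        have hlt : Module.finrank K ↥(D t ⊓ (D p ⊔ D q)) < n := by
          rw [← hr t ht]
          apply Submodule.finrank_lt_finrank_of_lt
          exact lt_of_le_of_ne inf_le_left fun he => hnot (inf_eq_left.1 he)
        have e1 : D p ⊓ D q = D t ⊓ (D p ⊔ D q) :=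
          Submodule.eq_of_le_of_finrank_le (le_inf hW (inf_le_left.trans le_sup_left)) (by omega)
        have htr := hp t ht r hrs
        have e2 : D t ⊓ D r = D t ⊓ (D p ⊔ D q) :=
          Submodule.eq_of_le_of_finrank_le (inf_le_inf le_rfl (third r hrs hrn)) (by omega)
        exact hrn (by rw [e1, ← e2]; exact inf_le_right)
      have h1 := Submodule.finrank_mono hU
      have h2 := Submodule.finrank_sup_add_finrank_inf_eq (D p) (D q)
      have := hr p hps
      have := hr q hqs
      omega
  · push Not at hne
    rcases s.eq_empty_or_nonempty with rfl | ⟨p, hps⟩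
    · left
      have h0 : (⨆ i ∈ (∅ : Set I), D i) = ⊥ := by
        rw [eq_bot_iff]
        exact iSup₂_le fun i hi => hi.elim
      rw [h0, finrank_bot]
      omega
    · right
      have : D p ≤ ⨅ i ∈ s, D i := le_iInf₂ fun i hi => (hne p hps i hi).le
      have := Submodule.finrank_mono this
      have := hr p hps
      omega

lemma map_mem_decompSpan (f : V →ₗ[K] V) {A : ExteriorAlgebra K V} {w : V}
    (h : w ∈ decompSpan K A) : f w ∈ decompSpan K (ExteriorAlgebra.map f A) := by
  rw [mem_decompSpan] at h ⊢
  rw [← ExteriorAlgebra.map_apply_ι, ← map_mul, h, map_zero]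

lemma map_eq_of_le {G : Type*} [Group G] (Ad : G →* (V ≃ₗ[K] V)) (W : Submodule K V)
    (h : ∀ g, ∀ v ∈ W, Ad g v ∈ W) (g : G) :
    Submodule.map ((Ad g : V ≃ₗ[K] V) : V →ₗ[K] V) W = W := by
  apply le_antisymm
  · rintro _ ⟨v, hv, rfl⟩
    exact h g v hv
  · intro v hv
    refine ⟨Ad g⁻¹ v, h _ _ hv, ?_⟩
    change (Ad g * Ad g⁻¹) v = v
    rw [← map_mul]
    simp

end Helpers

/-- For a 1-cocycle `Λ̃ : G → Λⁿ𝔤` (w.r.t. `Ad`) with decomposable values, the span `V_∪` of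
the subspaces `D_{Λ̃(g)}`, `g ∈ G₀ = {g : Λ̃(g) ≠ 0}`, and the intersection `V_∩` are
`Ad_G`-invariant, and `dim V_∪ ≤ n+1` or `dim V_∩ ≥ n−1`. -/
theorem cocycle_decomposable_values {K 𝔤 G : Type*} [Field K] [AddCommGroup 𝔤]
    [Module K 𝔤] [FiniteDimensional K 𝔤] [Group G] {n : ℕ}
    (Ad : G →* (𝔤 ≃ₗ[K] 𝔤))
    (Λ : G → ExteriorAlgebra K 𝔤)
    (hcoc : ∀ g g', Λ (g * g') = Λ g + ExteriorAlgebra.map (Ad g).toLinearMap (Λ g'))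
    (hdec : ∀ g, ∃ v : Fin n → 𝔤, Λ g = wedgeProd K v)
    (G₀ : Set G) (hG₀ : G₀ = {g : G | Λ g ≠ 0})
    (Vcup Vcap : Submodule K 𝔤)
    (hVcup : Vcup = ⨆ g ∈ G₀, decompSpan K (Λ g))
    (hVcap : Vcap = ⨅ g ∈ G₀, decompSpan K (Λ g)) :
    (∀ g : G, Submodule.map ((Ad g : 𝔤 ≃ₗ[K] 𝔤) : 𝔤 →ₗ[K] 𝔤) Vcup = Vcup) ∧
    (∀ g : G, Submodule.map ((Ad g : 𝔤 ≃ₗ[K] 𝔤) : 𝔤 →ₗ[K] 𝔤) Vcap = Vcap) ∧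
    (Module.finrank K ↥Vcup ≤ n + 1 ∨ n - 1 ≤ Module.finrank K ↥Vcap) := by
  subst hG₀
  have hone : Λ 1 = 0 := by
    have h := hcoc 1 1
    have h2 : (Ad 1).toLinearMap = LinearMap.id := by rw [map_one]; rfl
    rw [h2, ExteriorAlgebra.map_id, mul_one] at h
    simpa using h
  -- differences of values are translates of values
  have hsub : ∀ g g', ExteriorAlgebra.map (Ad g).toLinearMap (Λ g') = Λ (g * g') - Λ g := by
    intro g g'
    rw [hcoc]
    abel
  refine ⟨map_eq_of_le Ad Vcup ?_, map_eq_of_le Ad Vcap ?_, ?_⟩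
  · intro g v hv
    suffices hle : Vcup ≤ Vcup.comap (Ad g).toLinearMap from hle hv
    conv_lhs => rw [hVcup]
    refine iSup₂_le fun g' hg' v hv => ?_
    have h1 := map_mem_decompSpan (Ad g).toLinearMap hv
    rw [hsub] at h1
    have hE : ∀ k, Λ k ≠ 0 → decompSpan K (Λ k) ≤ Vcup := by
      intro k hk
      rw [hVcup]
      exact le_iSup₂_of_le k hk le_rfl
    refine decompSpan_sub_le (hdec _) (hdec _) ?_ Vcup (hE _) (hE _) h1
    intro he
    apply hg'
    have e1 := hcoc g⁻¹ (g * g')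
    have e2 := hcoc g⁻¹ g
    rw [he, ← e2] at e1
    simpa [hone] using e1
  · intro g v hv
    have hv' : ∀ k, ExteriorAlgebra.ι K v * Λ k = 0 := by
      intro k
      by_cases hk : Λ k = 0
      · simp [hk]
      rw [hVcap] at hv
      exact mem_decompSpan.1 ((iInf₂_le k hk : _ ≤ decompSpan K (Λ k)) hv)
    rw [hVcap]
    simp only [Submodule.mem_iInf]
    intro g' _
    have e : Λ g' = ExteriorAlgebra.map (Ad g).toLinearMap (Λ (g⁻¹ * g') - Λ g⁻¹) := by
      rw [map_sub, hsub, hsub]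
      simp [hone]
    rw [e]
    apply map_mem_decompSpan (Ad g).toLinearMap
    rw [mem_decompSpan, mul_sub, hv', hv', sub_zero]
  · rw [hVcup, hVcap]
    refine planes _ (fun g => decompSpan K (Λ g)) (fun g hg => finrank_decompSpan (hdec g) hg) ?_
    intro g hg g' hg'
    refine inter_dim (hdec g) (hdec g') ?_ hg hg'
    obtain ⟨v, hv⟩ := hdec (g'⁻¹ * g)
    refine ⟨(Ad g').toLinearMap ∘ v, ?_⟩
    rw [← map_wedgeProd, ← hv, hsub]
    simp
end
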